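/- arXiv:1308.3813 — 3 statements merged into one kernel-verified Lean document; each statement's English description precedes it below -/
import Mathlib

section
/- Let n be a finite nonempty index type, let M be a symmetric real matrix of size n × n, let d : n → ℝ, and let δ : ℝ. Form the symmetric block matrix N of size (1 + n) × (1 + n) whose top-left entry is δ, whose remaining first row and first column are given by d, and whose lower-right block is M (i.e. N = Matrix.fromBlocks !![δ] (Matrix.row d) (Matrix.col d) M, suitably reindexed). Suppose that (a) there exists w : n → ℝ with w ⬝ᵥ M.mulVec w > 0, and (b) d does not lie in the range of the linear map x ↦ M.mulVec x. Then there exist two linearly independent vectors u₁, u₂ : (Unit ⊕ n) → ℝ such that the quadratic form x ↦ x ⬝ᵥ N.mulVec x is positive definite on the span of u₁ and u₂ (i.e. every nonzero linear combination a·u₁ + b·u₂ has strictly positive value under the form). -/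
open Matrix

/-- If the symmetric matrix `M` admits a vector of positive quadratic value and `d` is not
in the range of `x ↦ M.mulVec x`, then the symmetric block matrix
`N = fromBlocks !![δ] (row d) (col d) M` has a two-dimensional subspace on which its
quadratic form is positive definite. -/
theorem stmt0 {n : Type*} [Fintype n] [DecidableEq n] [Nonempty n]
    (M : Matrix n n ℝ) (hM : Mᵀ = M) (d : n → ℝ) (δ : ℝ)
    (hw : ∃ w : n → ℝ, 0 < w ⬝ᵥ M.mulVec w)
    (hd : d ∉ Set.range fun x : n → ℝ => M.mulVec x) :
    ∃ u₁ u₂ : (Unit ⊕ n) → ℝ,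
      LinearIndependent ℝ ![u₁, u₂] ∧
      ∀ a b : ℝ, ¬(a = 0 ∧ b = 0) →
        0 < (a • u₁ + b • u₂) ⬝ᵥ
            (Matrix.fromBlocks (Matrix.of fun (_ _ : Unit) => δ)
              (Matrix.of fun (_ : Unit) j => d j)
              (Matrix.of fun i (_ : Unit) => d i) M).mulVec
            (a • u₁ + b • u₂) := by
  obtain ⟨w, hw⟩ := hw
  obtain ⟨k, hk, hdk⟩ : ∃ k : n → ℝ, M.mulVec k = 0 ∧ d ⬝ᵥ k ≠ 0 := by
    have hd' : d ∉ LinearMap.range M.mulVecLin := by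
      intro h
      obtain ⟨x, hx⟩ := h
      exact hd ⟨x, hx⟩
    obtain ⟨f, hf, hfp⟩ := Submodule.exists_le_ker_of_notMem hd'
    have key : ∀ y, f y = y ⬝ᵥ (dotProductEquiv ℝ n).symm f := by
      intro y
      rw [dotProduct_comm]
      exact (LinearMap.congr_fun ((dotProductEquiv ℝ n).apply_symm_apply f) y).symm
    refine ⟨(dotProductEquiv ℝ n).symm f, ?_, ?_⟩
    · apply dotProduct_eq_zero
      intro x
      have h0 : f (M.mulVec x) = 0 := hfp ⟨x, rfl⟩
      rw [key, dotProduct_comm, dotProduct_mulVec, ← mulVec_transpose, hM] at h0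
      exact h0
    · rw [← key]; exact hf
  set P := w ⬝ᵥ M.mulVec w with hP
  set D := d ⬝ᵥ w with hD
  set e := d ⬝ᵥ k with he
  obtain ⟨t, ht⟩ : ∃ t : ℝ, P * (δ + 2 * t * e) = D ^ 2 + 1 := by
    refine ⟨((D ^ 2 + 1) / P - δ) / (2 * e), ?_⟩
    have := hw.ne'
    field_simp
    ring
  have main : ∀ a b : ℝ, ¬(a = 0 ∧ b = 0) →
        0 < (a • (Sum.elim (fun _ => 0) w : Unit ⊕ n → ℝ) + b • Sum.elim (fun _ => 1) (t • k)) ⬝ᵥ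
            (Matrix.fromBlocks (Matrix.of fun (_ _ : Unit) => δ)
              (Matrix.of fun (_ : Unit) j => d j)
              (Matrix.of fun i (_ : Unit) => d i) M).mulVec
            (a • (Sum.elim (fun _ => 0) w : Unit ⊕ n → ℝ) +
              b • Sum.elim (fun _ => 1) (t • k)) := by
    intro a b hab
    have hv : (a • (Sum.elim (fun _ => 0) w : Unit ⊕ n → ℝ) + b • Sum.elim (fun _ => 1) (t • k))
        = Sum.elim (fun _ => b) (a • w + (b * t) • k) := by
      ext i
      rcases i with i | i <;> simp [mul_assoc]
    have h1 : (Matrix.of fun (_ : Unit) j => d j) *ᵥ (a • w + (b * t) • k)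
        = fun _ => a * D + b * t * e := by
      ext i
      change d ⬝ᵥ (a • w + (b * t) • k) = _
      simp [dotProduct_add, hD, he]
    have h2 : (Matrix.of fun i (_ : Unit) => d i) *ᵥ (fun _ => b) = b • d := by
      ext i
      simp [mulVec, dotProduct, mul_comm]
    have h3 : (Matrix.of fun (_ _ : Unit) => δ) *ᵥ (fun _ => b) = fun _ => δ * b := by
      ext i
      simp [mulVec, dotProduct]
    have h4 : k ⬝ᵥ M *ᵥ w = 0 := by
      rw [dotProduct_mulVec, ← mulVec_transpose, hM, hk, zero_dotProduct]
    have hq : ((a • (Sum.elim (fun _ => 0) w : Unit ⊕ n → ℝ) +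
              b • Sum.elim (fun _ => 1) (t • k)) ⬝ᵥ
            (Matrix.fromBlocks (Matrix.of fun (_ _ : Unit) => δ)
              (Matrix.of fun (_ : Unit) j => d j)
              (Matrix.of fun i (_ : Unit) => d i) M).mulVec
            (a • (Sum.elim (fun _ => 0) w : Unit ⊕ n → ℝ) +
              b • Sum.elim (fun _ => 1) (t • k))) =
        a ^ 2 * P + 2 * a * b * D + b ^ 2 * (δ + 2 * t * e) := by
      rw [hv, fromBlocks_mulVec, sumElim_dotProduct_sumElim]
      simp only [Sum.elim_comp_inl, Sum.elim_comp_inr]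
      rw [h1, h2, h3, mulVec_add, mulVec_smul, mulVec_smul, hk]
      simp only [smul_zero, add_zero, dotProduct_add, add_dotProduct, smul_dotProduct,
        dotProduct_smul, smul_eq_mul, h4, ← hP, dotProduct_comm w d, dotProduct_comm k d,
        ← hD, ← he]
      simp [dotProduct]
      ring
    rw [hq]
    have hPq : P * (a ^ 2 * P + 2 * a * b * D + b ^ 2 * (δ + 2 * t * e))
        = (a * P + b * D) ^ 2 + b ^ 2 := by
      linear_combination b ^ 2 * ht
    have hpos : 0 < (a * P + b * D) ^ 2 + b ^ 2 := by
      by_cases hb : b = 0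
      · have ha : a ≠ 0 := fun h => hab ⟨h, hb⟩
        subst hb
        have := hw.ne'
        simp only [zero_mul, add_zero]
        positivity
      · positivity
    rw [← hPq] at hpos
    exact (pos_iff_pos_of_mul_pos hpos).mp hw
  refine ⟨_, _, ?_, main⟩
  rw [LinearIndependent.pair_iff]
  intro a b h
  by_contra hab
  have := main a b hab
  rw [h, zero_dotProduct] at this
  exact lt_irrefl _ this
end

section
/- Let a, b, c be real numbers with c > 0, and let M be the 3 × 3 real symmetric matrix !![a, b, 1; b, c, 0; 1, 0, 0]. Then M is nonsingular and has exactly two positive eigenvalues and exactly one negative eigenvalue (counted with multiplicity); that is, M has signature (2, 1). -/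
open Matrix
open scoped Classical

lemma sign_aux (f : Fin 3 → ℝ) (a b c : ℝ) (hc : 0 < c)
    (h1 : f 0 + f 1 + f 2 = a + c)
    (h2 : f 0 * f 1 + f 0 * f 2 + f 1 * f 2 = a * c - b ^ 2 - 1)
    (h3 : f 0 * f 1 * f 2 = -c) :
    (Finset.univ.filter fun i => 0 < f i).card = 2 ∧
      (Finset.univ.filter fun i => f i < 0).card = 1 := by
  have key : ¬ (f 0 < 0 ∧ f 1 < 0 ∧ f 2 < 0) := by
    rintro ⟨h, h', h''⟩
    have p1 := mul_pos_of_neg_of_neg h h'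
    have p2 := mul_pos_of_neg_of_neg h h''
    have p3 := mul_pos_of_neg_of_neg h' h''
    have ha : a < 0 := by linarith
    nlinarith [mul_neg_of_neg_of_pos ha hc, sq_nonneg b]
  have n0 : f 0 ≠ 0 := by intro h; rw [h] at h3; linarith
  have n1 : f 1 ≠ 0 := by intro h; rw [h] at h3; linarith
  have n2 : f 2 ≠ 0 := by intro h; rw [h] at h3; linarith
  simp only [Finset.card_filter, Fin.sum_univ_three]
  rcases lt_or_gt_of_ne n0 with s0 | s0 <;> rcases lt_or_gt_of_ne n1 with s1 | s1 <;>
    rcases lt_or_gt_of_ne n2 with s2 | s2 <;>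
    first
    | exact (key (And.intro s0 (And.intro s1 s2))).elim
    | (simp [s0, s1, s2, s0.le, s1.le, s2.le, s0.not_gt, s1.not_gt, s2.not_gt]; done)
    | (exfalso
       have q : 0 < f 0 * f 1 * f 2 := by
         first
         | exact mul_pos (mul_pos s0 s1) s2
         | exact mul_pos (mul_pos_of_neg_of_neg s0 s1) s2
         | exact mul_pos_of_neg_of_neg (mul_neg_of_neg_of_pos s0 s1) s2
         | exact mul_pos_of_neg_of_neg (mul_neg_of_pos_of_neg s0 s1) s2
       linarith)

/-- The symmetric matrix `!![a, b, 1; b, c, 0; 1, 0, 0]` with `c > 0` is nonsingular with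
exactly two positive eigenvalues and exactly one negative eigenvalue. -/
theorem stmt1 (a b c : ℝ) (hc : 0 < c) :
    (!![a, b, 1; b, c, 0; 1, 0, 0] : Matrix (Fin 3) (Fin 3) ℝ).det ≠ 0 ∧
    ∃ hM : (!![a, b, 1; b, c, 0; 1, 0, 0] : Matrix (Fin 3) (Fin 3) ℝ).IsHermitian,
      (Finset.univ.filter fun i => 0 < hM.eigenvalues i).card = 2 ∧
      (Finset.univ.filter fun i => hM.eigenvalues i < 0).card = 1 := by
  have hM : (!![a, b, 1; b, c, 0; 1, 0, 0] : Matrix (Fin 3) (Fin 3) ℝ).IsHermitian := by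
    ext i j
    fin_cases i <;> fin_cases j <;> simp
  refine ⟨by simp [Matrix.det_fin_three, hc.ne'], hM, ?_⟩
  have hp : ∀ t : ℝ, (t - hM.eigenvalues 0) * (t - hM.eigenvalues 1) * (t - hM.eigenvalues 2)
      = t ^ 3 - (a + c) * t ^ 2 + (a * c - b ^ 2 - 1) * t + c := by
    intro t
    have h := congrArg (Polynomial.eval t) hM.charpoly_eq
    rw [Matrix.eval_charpoly, Polynomial.eval_prod, Fin.prod_univ_three] at h
    simp [Matrix.det_fin_three] at h
    rw [← h]
    ring
  have e0 := hp 0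
  have e1 := hp 1
  have e2 := hp (-1)
  exact sign_aux _ a b c hc (by linarith) (by linarith) (by linarith)
end

section
/- Let V be a real vector space and let B : V →ₗ[ℝ] V →ₗ[ℝ] ℝ be a symmetric bilinear form such that there is no two-dimensional subspace of V on which B is positive definite (i.e. there do not exist linearly independent u₁, u₂ with B(a·u₁ + b·u₂)(a·u₁ + b·u₂) > 0 for all (a,b) ≠ (0,0)). Then for any finite family of vectors v : Fin k → V, the Gram matrix G with G i j = B (v i) (v j), which is a real symmetric k × k matrix, has at most one positive eigenvalue (counted with multiplicity). -/
open Matrix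
open scoped Classical

/-- If a symmetric bilinear form on a real vector space has no two-dimensional positive
definite subspace, then the Gram matrix of any finite family of vectors has at most one
positive eigenvalue. -/
theorem stmt8 {V : Type*} [AddCommGroup V] [Module ℝ V]
    (B : V →ₗ[ℝ] V →ₗ[ℝ] ℝ) (hsymm : ∀ v w : V, B v w = B w v)
    (hneg : ¬ ∃ u₁ u₂ : V, LinearIndependent ℝ ![u₁, u₂] ∧
      ∀ a b : ℝ, ¬(a = 0 ∧ b = 0) →
        0 < B (a • u₁ + b • u₂) (a • u₁ + b • u₂))
    (k : ℕ) (v : Fin k → V) :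
    ∃ hG : (Matrix.of fun i j : Fin k => B (v i) (v j)).IsHermitian,
      (Finset.univ.filter fun i => 0 < hG.eigenvalues i).card ≤ 1 := by
  have hG : (Matrix.of fun i j : Fin k => B (v i) (v j)).IsHermitian := by
    ext i j
    simp [Matrix.conjTranspose_apply, hsymm (v j) (v i)]
  refine ⟨hG, ?_⟩
  rw [Finset.card_le_one]
  intro i hi j hj
  by_contra hij
  have hi := (Finset.mem_filter.1 hi).2
  have hj := (Finset.mem_filter.1 hj).2
  have key : ∀ x y : Fin k → ℝ, B (∑ l, x l • v l) (∑ l, y l • v l) =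
      x ⬝ᵥ ((Matrix.of fun i j : Fin k => B (v i) (v j)) *ᵥ y) := by
    intro x y
    simp only [map_sum, LinearMap.sum_apply, map_smul, LinearMap.smul_apply, smul_eq_mul,
      dotProduct, Matrix.mulVec, Matrix.of_apply, Finset.mul_sum]
    rw [Finset.sum_comm]
    refine Finset.sum_congr rfl fun a _ => Finset.sum_congr rfl fun b _ => ?_
    ring
  set u : Fin k → V := fun i => ∑ l, (hG.eigenvectorBasis i) l • v l with hu
  have hB : ∀ a b, B (u a) (u b) = if a = b then hG.eigenvalues b else 0 := by
    intro a b
    have h1 := key (hG.eigenvectorBasis a).ofLp (hG.eigenvectorBasis b).ofLp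
    have h2 := orthonormal_iff_ite.1 hG.eigenvectorBasis.orthonormal b a
    rw [hG.mulVec_eigenvectorBasis, dotProduct_smul] at h1
    rw [EuclideanSpace.inner_eq_star_dotProduct, star_trivial] at h2
    rw [hu]
    refine h1.trans ?_
    rw [h2]
    by_cases h : a = b
    · simp [h]
    · simp [h, Ne.symm h]
  have hpos : ∀ a b : ℝ, ¬(a = 0 ∧ b = 0) →
      0 < B (a • u i + b • u j) (a • u i + b • u j) := by
    intro a b hab
    have e : B (a • u i + b • u j) (a • u i + b • u j) =
        a ^ 2 * hG.eigenvalues i + b ^ 2 * hG.eigenvalues j := by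
      simp only [map_add, map_smul, LinearMap.add_apply, LinearMap.smul_apply, hB, smul_eq_mul,
        if_neg hij, if_neg (Ne.symm hij), if_true]
      ring
    rw [e]
    by_cases ha : a = 0
    · have hb : b ≠ 0 := fun hb => hab ⟨ha, hb⟩
      have := hi.le
      positivity
    · have := hj.le
      positivity
  refine hneg ⟨u i, u j, ?_, hpos⟩
  rw [LinearIndependent.pair_iff]
  intro a b h
  by_contra hab
  have := hpos a b hab
  rw [h] at this
  simp at this
end
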